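/- arXiv:1910.09786 — 8 statements merged into one kernel-verified Lean document; each statement's English description precedes it below -/
import Mathlib

section
/- Under the lowest-stake selection mechanism with unit rewards and zero initial stakes, the stake of every process has the closed form s h i = (h*n + (N - 1 - i)) / N (natural-number division), for every height h and every process i. -/
theorem mul_add_add_sub_div {N q r i : ℕ} (hr : r < N) (hi : i < N) :
    (N * q + r + (N - 1 - i)) / N = q + if i < r then 1 else 0 := by
  rw [add_assoc, Nat.mul_add_div (by omega)]
  congr 1
  split_ifs with h
  · exact Nat.div_eq_of_lt_le (by omega) (by omega)
  · exact Nat.div_eq_of_lt (by omega)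

theorem card_lexSmaller {N q r : ℕ} (hr : r < N) (t : Fin N → ℕ)
    (ht : ∀ i, t i = q + if i.val < r then 1 else 0) (i : Fin N) :
    (Finset.univ.filter (fun j : Fin N =>
      t j < t i ∨ (t j = t i ∧ j.val < i.val))).card =
      if i.val < r then i.val + (N - r) else i.val - r := by
  have hi := i.isLt
  rw [← Finset.card_map Fin.valEmbedding]
  split_ifs with h
  · have hdisj : Disjoint (Finset.range i) (Finset.Ico r N) := by
      rw [Finset.disjoint_left]
      intro a ha hb
      simp only [Finset.mem_range, Finset.mem_Ico] at ha hb
      omega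
    trans (Finset.range i ∪ Finset.Ico r N).card
    swap
    · rw [Finset.card_union_of_disjoint hdisj, Finset.card_range, Nat.card_Ico]
    congr 1
    ext a
    simp only [Finset.mem_map, Finset.mem_filter, Finset.mem_univ, true_and, Finset.mem_union,
      Finset.mem_range, Finset.mem_Ico, ht, if_pos h, Fin.valEmbedding_apply]
    constructor
    · rintro ⟨j, hj, rfl⟩
      have := j.isLt
      split_ifs at hj <;> omega
    · intro ha
      refine ⟨⟨a, by omega⟩, ?_, rfl⟩
      dsimp only
      split_ifs <;> omega
  · rw [← Nat.card_Ico]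
    congr 1
    ext a
    simp only [Finset.mem_map, Finset.mem_filter, Finset.mem_univ, true_and,
      Finset.mem_Ico, ht, if_neg h, Fin.valEmbedding_apply]
    constructor
    · rintro ⟨j, hj, rfl⟩
      split_ifs at hj <;> omega
    · intro ha
      refine ⟨⟨a, by omega⟩, ?_, rfl⟩
      dsimp only
      split_ifs <;> omega

/-- **Lowest-stake selection mechanism, closed form of stakes.**
Fix `N n : ℕ` with `0 < n` and `n ≤ N`. Stakes `s : ℕ → Fin N → ℕ` and committees
`C : ℕ → Finset (Fin N)` satisfy: initial stakes are `0`; a process `i` is in the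
committee at height `h` iff fewer than `n` processes `j` are lexicographically smaller
(on the pair (stake, index)); each committee member gets reward `1`.
Then `s h i = (h*n + (N - 1 - i)) / N` (natural division). -/
theorem lowest_stake_closed_form
    (N n : ℕ) (hn : 0 < n) (hnN : n ≤ N)
    (s : ℕ → Fin N → ℕ) (C : ℕ → Finset (Fin N))
    (hs0 : ∀ i, s 0 i = 0)
    (hC : ∀ h (i : Fin N), i ∈ C h ↔
      (Finset.univ.filter (fun j : Fin N =>
        s h j < s h i ∨ (s h j = s h i ∧ j.val < i.val))).card < n)
    (hstep : ∀ h (i : Fin N), s (h+1) i = s h i + (if i ∈ C h then 1 else 0)) :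
    ∀ h (i : Fin N), s h i = (h * n + (N - 1 - i.val)) / N := by
  intro h
  induction h with
  | zero =>
    intro i
    rw [hs0, Nat.div_eq_of_lt]
    have := i.isLt
    omega
  | succ h ih =>
    intro i
    have hi := i.isLt
    have hr : h * n % N < N := Nat.mod_lt _ (by omega)
    have hT := Nat.div_add_mod (h * n) N
    have hT' : (h + 1) * n = h * n + n := Nat.succ_mul h n
    generalize h * n / N = q at hT
    generalize h * n % N = r at hT hr
    have hs : ∀ j, s h j = q + if j.val < r then 1 else 0 := fun j => by
      rw [ih, ← hT, mul_add_add_sub_div hr j.isLt]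
    have hmem := hC h i
    rw [card_lexSmaller hr _ hs] at hmem
    rw [hstep, hs, hT', ← hT]
    simp only [hmem]
    rcases lt_or_ge (r + n) N with hlt | hge
    · rw [add_assoc (N * q), mul_add_add_sub_div hlt hi]
      split_ifs <;> omega
    · rcases Nat.lt_or_ge (r + n - N) N with hlt' | _
      · have : N * q + r + n = N * (q + 1) + (r + n - N) := by
          rw [Nat.mul_succ]; omega
        rw [this, mul_add_add_sub_div hlt' hi]
        split_ifs <;> omega
      · omega
end

section
/- The lowest-stake selection mechanism with unit rewards behaves like round-robin: for every height h and every process i, i belongs to the committee C h if and only if there exists m with h*n ≤ m < h*n + n and m % N = i.val. -/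
/-- If the stakes are `q + 1` below `r` and `q` from `r` on, then process `i` has
lexicographic rank `i - r` when `r ≤ i` and `N - r + i` otherwise. -/
theorem card_lex_lt_of_two_levels {N q r : ℕ} (hr : r < N) (t : Fin N → ℕ)
    (ht : ∀ i, t i = q + if i.val < r then 1 else 0) (i : Fin N) :
    (Finset.univ.filter (fun j : Fin N =>
      t j < t i ∨ (t j = t i ∧ j.val < i.val))).card =
      if i.val < r then N - r + i.val else i.val - r := by
  rw [← Finset.card_map Fin.valEmbedding]
  have hi := i.isLt
  split_ifs with hir
  · have hset : (Finset.univ.filter (fun j : Fin N =>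
        t j < t i ∨ (t j = t i ∧ j.val < i.val))).map Fin.valEmbedding =
        Finset.Ico r N ∪ Finset.range i.val := by
      ext k
      simp only [Finset.mem_map, Finset.mem_filter, Finset.mem_univ, true_and, ht,
        Fin.valEmbedding_apply, Finset.mem_union, Finset.mem_Ico, Finset.mem_range]
      constructor
      · rintro ⟨j, hj, rfl⟩
        have := j.isLt
        split_ifs at hj <;> omega
      · intro hk
        refine ⟨⟨k, by omega⟩, ?_, rfl⟩
        dsimp only
        split_ifs <;> omega
    rw [hset, Finset.card_union_of_disjoint, Nat.card_Ico, Finset.card_range]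
    rw [Finset.disjoint_left]
    intro k
    simp only [Finset.mem_Ico, Finset.mem_range]
    omega
  · have hset : (Finset.univ.filter (fun j : Fin N =>
        t j < t i ∨ (t j = t i ∧ j.val < i.val))).map Fin.valEmbedding =
        Finset.Ico r i.val := by
      ext k
      simp only [Finset.mem_map, Finset.mem_filter, Finset.mem_univ, true_and, ht,
        Fin.valEmbedding_apply, Finset.mem_Ico]
      constructor
      · rintro ⟨j, hj, rfl⟩
        split_ifs at hj <;> omega
      · intro hk
        refine ⟨⟨k, by omega⟩, ?_, rfl⟩
        dsimp only
        split_ifs <;> omega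
    rw [hset, Nat.card_Ico]

/-- A window of `n ≤ N` consecutive naturals starting at `q * N + r` contains a number
congruent to `i` modulo `N` iff the cyclic distance from `r` to `i` is less than `n`. -/
theorem exists_mod_eq_in_window_iff {N n q r i : ℕ} (hnN : n ≤ N) (hr : r < N) (hi : i < N) :
    (∃ m : ℕ, q * N + r ≤ m ∧ m < q * N + r + n ∧ m % N = i) ↔
      (if i < r then N - r + i else i - r) < n := by
  constructor
  · rintro ⟨m, h1, h2, h3⟩
    have hdiv := Nat.div_add_mod m N
    have hlow : q ≤ m / N := (Nat.le_div_iff_mul_le (by omega)).2 (by omega)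
    have hupp : m / N < q + 2 := (Nat.div_lt_iff_lt_mul (by omega)).2 (by rw [add_mul]; omega)
    obtain hq | hq : m / N = q ∨ m / N = q + 1 := by omega
    · rw [hq, mul_comm] at hdiv
      split_ifs <;> omega
    · rw [hq, mul_comm, add_mul] at hdiv
      split_ifs <;> omega
  · intro h
    split_ifs at h with hir
    · refine ⟨(q + 1) * N + i, ?_, ?_, ?_⟩
      · rw [add_mul]; omega
      · rw [add_mul]; omega
      · rw [Nat.mul_add_mod_self_right, Nat.mod_eq_of_lt hi]
    · refine ⟨q * N + i, by omega, by omega, ?_⟩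
      rw [Nat.mul_add_mod_self_right, Nat.mod_eq_of_lt hi]

/-- **Lowest-stake selection is round-robin.**
Under the lowest-stake selection mechanism with unit rewards, for every height `h`
and process `i`: `i ∈ C h` iff there exists `m` with `h*n ≤ m < h*n + n` and
`m % N = i`. -/
theorem lowest_stake_round_robin
    (N n : ℕ) (hn : 0 < n) (hnN : n ≤ N)
    (s : ℕ → Fin N → ℕ) (C : ℕ → Finset (Fin N))
    (hs0 : ∀ i, s 0 i = 0)
    (hC : ∀ h (i : Fin N), i ∈ C h ↔
      (Finset.univ.filter (fun j : Fin N =>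
        s h j < s h i ∨ (s h j = s h i ∧ j.val < i.val))).card < n)
    (hstep : ∀ h (i : Fin N), s (h+1) i = s h i + (if i ∈ C h then 1 else 0)) :
    ∀ h (i : Fin N), i ∈ C h ↔
      ∃ m : ℕ, h * n ≤ m ∧ m < h * n + n ∧ m % N = i.val := by
  have hlevels : ∀ h, ∃ q r, h * n = q * N + r ∧ r < N ∧
      ∀ i : Fin N, s h i = q + if i.val < r then 1 else 0 := by
    intro h
    induction h with
    | zero => exact ⟨0, 0, by simp, by omega, fun i => by simp [hs0]⟩
    | succ h ih =>
      obtain ⟨q, r, hqr, hr, hs⟩ := ih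
      have hmem : ∀ i : Fin N, i ∈ C h ↔
          (if i.val < r then N - r + i.val else i.val - r) < n := fun i => by
        rw [hC, card_lex_lt_of_two_levels hr (s h) hs]
      by_cases hlt : r + n < N
      · refine ⟨q, r + n, by rw [add_mul]; omega, hlt, fun i => ?_⟩
        have := i.isLt
        simp only [hstep, hs, hmem]
        split_ifs <;> omega
      · refine ⟨q + 1, r + n - N, by rw [add_mul, add_mul]; omega, by omega, fun i => ?_⟩
        have := i.isLt
        simp only [hstep, hs, hmem]
        split_ifs <;> omega
  intro h i
  obtain ⟨q, r, hqr, hr, hs⟩ := hlevels h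
  rw [hC, card_lex_lt_of_two_levels hr (s h) hs, hqr, exists_mod_eq_in_window_iff hnN hr i.isLt]
end

section
/- The lowest-stake selection mechanism with unit rewards satisfies the first fairness condition for selection mechanisms: every process is selected infinitely often, i.e. for every process i and every height h there exists h' ≥ h with i ∈ C h'. -/
/-- **Lowest-stake selection satisfies fairness condition 1.**
Under the lowest-stake selection mechanism with unit rewards, every process is
selected infinitely often: for every process `i` and height `h` there is `h' ≥ h`
with `i ∈ C h'`. -/
theorem lowest_stake_selected_infinitely_often
    (N n : ℕ) (hn : 0 < n) (hnN : n ≤ N)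
    (s : ℕ → Fin N → ℕ) (C : ℕ → Finset (Fin N))
    (hs0 : ∀ i, s 0 i = 0)
    (hC : ∀ h (i : Fin N), i ∈ C h ↔
      (Finset.univ.filter (fun j : Fin N =>
        s h j < s h i ∨ (s h j = s h i ∧ j.val < i.val))).card < n)
    (hstep : ∀ h (i : Fin N), s (h+1) i = s h i + (if i ∈ C h then 1 else 0)) :
    ∀ (i : Fin N) (h : ℕ), ∃ h' ≥ h, i ∈ C h' := by
  intro i h
  by_contra! hnot
  have hconst : ∀ k, s (h + k) i = s h i := by
    intro k
    induction k with
    | zero => rfl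
    | succ k ih => rw [← add_assoc, hstep, if_neg (hnot _ (Nat.le_add_right h k)), ih, add_zero]
  have hmin : ∀ k, ∃ m ∈ C k, s k m ≤ s k i := by
    intro k
    obtain ⟨m, -, hm⟩ := Finset.exists_min_image Finset.univ
      (fun j : Fin N => toLex (s k j, j.val)) ⟨i, Finset.mem_univ i⟩
    simp only [Finset.mem_univ, forall_const, Prod.Lex.toLex_le_toLex] at hm
    refine ⟨m, ?_, by grind⟩
    rw [hC, Finset.card_eq_zero.mpr]
    · exact hn
    · refine Finset.filter_eq_empty_iff.mpr fun j _ hj => ?_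
      have := hm j
      omega
  have hdec : ∀ k, (∑ j, (s h i + 1 - s (h + k) j)) + k ≤ ∑ j, (s h i + 1 - s h j) := by
    intro k
    induction k with
    | zero => rfl
    | succ k ih =>
      obtain ⟨m, hmC, hm⟩ := hmin (h + k)
      rw [hconst] at hm
      have hlt : ∑ j, (s h i + 1 - s (h + (k + 1)) j) < ∑ j, (s h i + 1 - s (h + k) j) := by
        refine Finset.sum_lt_sum (fun j _ => ?_) ⟨m, Finset.mem_univ m, ?_⟩
        · rw [← add_assoc, hstep]
          omega
        · rw [← add_assoc, hstep, if_pos hmC]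
          omega
      omega
  have := hdec (∑ j, (s h i + 1 - s h j) + 1)
  omega
end

section
/- Under the lowest-stake selection mechanism with unit rewards, after l blocks every process has been selected approximately l*n/N times: for every process i and every l, (l*n)/N ≤ count i l and count i l ≤ (l*n + N - 1)/N, where the divisions are natural-number (floor) divisions. -/
open Finset in
/-- Ranking a finite type by an injective map into a linear order, exactly `n` elements have
fewer than `n` predecessors. -/
lemma card_filter_card_filter_lt_lt {ι β : Type*} [Fintype ι] [LinearOrder β] {f : ι → β}
    (hf : Function.Injective f) {n : ℕ} (hn : n ≤ Fintype.card ι) :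
    #{i | #{j | f j < f i} < n} = n := by
  have rank_lt_rank {a b : ι} (hab : f a < f b) : #{j | f j < f a} < #{j | f j < f b} := by
    refine card_lt_card (ssubset_iff_of_subset ?_ |>.2 ⟨a, by simpa using hab, by simp⟩)
    intro j hj
    simp only [mem_filter_univ] at hj ⊢
    exact hj.trans hab
  have rank_inj : Function.Injective fun i => #{j | f j < f i} := by
    intro a b hab
    by_contra hne
    rcases lt_or_gt_of_ne (hf.ne hne) with h | h
    · exact (rank_lt_rank h).ne hab
    · exact (rank_lt_rank h).ne' hab
  have image_rank : univ.image (fun i => #{j | f j < f i}) = range (Fintype.card ι) := by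
    refine eq_of_subset_of_card_le (fun k hk => ?_) ?_
    · obtain ⟨i, -, rfl⟩ := mem_image.1 hk
      exact mem_range.2 (card_lt_univ_of_notMem (x := i) (by simp))
    · rw [card_image_of_injective _ rank_inj, card_range, card_univ]
  rw [← card_image_of_injective _ rank_inj, ← filter_image (p := (· < n)), image_rank]
  convert card_range n using 2
  ext k
  simp only [mem_filter, mem_range]
  omega

/-- If the values of a function on `Fin N` differ pairwise by at most one, each of them is the
average rounded down or up. -/
lemma div_le_and_le_div_of_le_add_one {N : ℕ} {f : Fin N → ℕ} (hf : ∀ i j, f i ≤ f j + 1)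
    (i : Fin N) : (∑ j, f j) / N ≤ f i ∧ f i ≤ (∑ j, f j + N - 1) / N := by
  have hN : 0 < N := i.pos
  constructor
  · have h : ∑ j, f j < ∑ _j : Fin N, (f i + 1) :=
      Finset.sum_lt_sum (fun j _ => hf j i) ⟨i, Finset.mem_univ i, Nat.lt_succ_self _⟩
    rw [Finset.sum_const, Finset.card_univ, Fintype.card_fin, smul_eq_mul, mul_comm] at h
    exact Nat.lt_succ_iff.1 ((Nat.div_lt_iff_lt_mul hN).2 h)
  · have h : ∑ _j : Fin N, f i < ∑ j, (f j + 1) :=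
      Finset.sum_lt_sum (fun j _ => hf i j) ⟨i, Finset.mem_univ i, Nat.lt_succ_self _⟩
    rw [Finset.sum_add_distrib, Finset.sum_const, Finset.sum_const, Finset.card_univ,
      Fintype.card_fin, smul_eq_mul, smul_eq_mul, mul_one, mul_comm] at h
    exact (Nat.le_div_iff_mul_le hN).2 (Nat.le_sub_one_of_lt h)

/-- **Lowest-stake selection: selection counts after `l` blocks.**
Under the lowest-stake selection mechanism with unit rewards, after `l` blocks every
process `i` has been selected between `(l*n)/N` and `(l*n + N - 1)/N` times
(natural-number floor divisions), where
`count i l = #{h < l : i ∈ C h}`. -/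
theorem lowest_stake_count_bounds
    (N n : ℕ) (hn : 0 < n) (hnN : n ≤ N)
    (s : ℕ → Fin N → ℕ) (C : ℕ → Finset (Fin N))
    (hs0 : ∀ i, s 0 i = 0)
    (hC : ∀ h (i : Fin N), i ∈ C h ↔
      (Finset.univ.filter (fun j : Fin N =>
        s h j < s h i ∨ (s h j = s h i ∧ j.val < i.val))).card < n)
    (hstep : ∀ h (i : Fin N), s (h+1) i = s h i + (if i ∈ C h then 1 else 0))
    (count : Fin N → ℕ → ℕ)
    (hcount : ∀ (i : Fin N) (l : ℕ),
      count i l = ((Finset.range l).filter (fun h => i ∈ C h)).card) :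
    ∀ (i : Fin N) (l : ℕ),
      (l * n) / N ≤ count i l ∧ count i l ≤ (l * n + N - 1) / N := by
  have count_eq (l : ℕ) (i : Fin N) : count i l = s l i := by
    rw [hcount]
    induction l with
    | zero => simp [hs0]
    | succ l ih =>
      rw [hstep, ← ih, Finset.range_add_one, Finset.filter_insert]
      split_ifs <;> simp
  have card_committee (h : ℕ) : (C h).card = n := by
    have key_inj : Function.Injective fun i : Fin N => toLex (s h i, i.val) := fun a b hab =>
      Fin.ext (congrArg (fun p => (ofLex p).2) hab)
    rw [← card_filter_card_filter_lt_lt key_inj (n := n) (by simpa using hnN)]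
    congr 1
    ext i
    simp only [hC, Finset.mem_filter_univ, Prod.Lex.toLex_lt_toLex]
  have sum_stake (l : ℕ) : ∑ i, s l i = l * n := by
    induction l with
    | zero => simp [hs0]
    | succ l ih =>
      simp only [hstep, Finset.sum_add_distrib, ih, Finset.sum_boole, Finset.filter_univ_mem,
        card_committee, Nat.cast_id, add_mul, one_mul]
  have stake_le_of_mem {h : ℕ} {i j : Fin N} (hi : i ∈ C h) (hj : j ∉ C h) : s h i ≤ s h j := by
    by_contra! hlt
    refine hj ((hC h j).2 (lt_of_le_of_lt (Finset.card_le_card fun k hk => ?_) ((hC h i).1 hi)))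
    simp only [Finset.mem_filter_univ] at hk ⊢
    omega
  have stake_le_add_one (l : ℕ) : ∀ i j, s l i ≤ s l j + 1 := by
    induction l with
    | zero => simp [hs0]
    | succ l ih =>
      intro i j
      have hij := ih i j
      have hmem := @stake_le_of_mem l i j
      rw [hstep, hstep]
      split_ifs with hi hj hj
      · omega
      · have := hmem hi hj
        omega
      · omega
      · omega
  intro i l
  rw [count_eq, ← sum_stake l]
  exact div_le_and_le_div_of_le_add_one (stake_le_add_one l) i
end

section
/- Under the lowest-stake selection mechanism with unit rewards, the numbers of selections of any two processes differ by at most one at every time: for all processes i, j and every l, count i l ≤ count j l + 1. -/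
/-- **Lowest-stake selection: counts differ by at most one.**
Under the lowest-stake selection mechanism with unit rewards, the numbers of
selections of any two processes differ by at most one at every time `l`, where
`count i l = #{h < l : i ∈ C h}`. -/
theorem lowest_stake_count_balanced
    (N n : ℕ) (hn : 0 < n) (hnN : n ≤ N)
    (s : ℕ → Fin N → ℕ) (C : ℕ → Finset (Fin N))
    (hs0 : ∀ i, s 0 i = 0)
    (hC : ∀ h (i : Fin N), i ∈ C h ↔
      (Finset.univ.filter (fun j : Fin N =>
        s h j < s h i ∨ (s h j = s h i ∧ j.val < i.val))).card < n)
    (hstep : ∀ h (i : Fin N), s (h+1) i = s h i + (if i ∈ C h then 1 else 0))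
    (count : Fin N → ℕ → ℕ)
    (hcount : ∀ (i : Fin N) (l : ℕ),
      count i l = ((Finset.range l).filter (fun h => i ∈ C h)).card) :
    ∀ (i j : Fin N) (l : ℕ), count i l ≤ count j l + 1 := by
  have mem_of_lt : ∀ h (i j : Fin N), s h j < s h i → i ∈ C h → j ∈ C h := by
    intro h i j hlt hi
    rw [hC] at hi ⊢
    refine (Finset.card_le_card ?_).trans_lt hi
    intro k hk
    simp only [Finset.mem_filter, Finset.mem_univ, true_and] at hk ⊢
    omega
  have stake_balanced : ∀ l (i j : Fin N), s l i ≤ s l j + 1 := by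
    intro l
    induction l with
    | zero => simp [hs0]
    | succ l ih =>
      intro i j
      have hij := ih i j
      have hmem := mem_of_lt l i j
      rw [hstep, hstep]
      split_ifs with hi hj
      · omega
      · have : ¬ s l j < s l i := fun hlt => hj (hmem hlt hi)
        omega
      · omega
      · omega
  have count_eq_stake : ∀ (i : Fin N) l, count i l = s l i := by
    intro i l
    rw [hcount, Finset.card_filter]
    induction l with
    | zero => simp [hs0]
    | succ l ih => rw [Finset.sum_range_succ, ih, hstep]
  intro i j l
  simpa only [count_eq_stake] using stake_balanced l i j
end

section
/- Under the lowest-stake selection mechanism with unit rewards, every process is selected with asymptotic frequency n/N: for every process i, the sequence l ↦ (count i l : ℝ) / l tends to (n : ℝ)/N as l → ∞. In particular all processes have the same selection frequency, so (the processes having equal merit) the second fairness condition for selection mechanisms is satisfied. -/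
/-- The rank of `i` with respect to the stake `f`, ties being broken by index. -/
def stakeRank {N : ℕ} (f : Fin N → ℕ) (i : Fin N) : ℕ :=
  (Finset.univ.filter (fun j : Fin N => f j < f i ∨ (f j = f i ∧ j.val < i.val))).card

lemma stakeRank_lt_of_lex {N : ℕ} (f : Fin N → ℕ) {i j : Fin N}
    (h : f i < f j ∨ (f i = f j ∧ i.val < j.val)) : stakeRank f i < stakeRank f j := by
  apply Finset.card_lt_card
  rw [Finset.ssubset_iff_of_subset]
  · exact ⟨i, by simpa using h, by simp⟩
  · intro k hk
    simp only [Finset.mem_filter, Finset.mem_univ, true_and] at hk ⊢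
    omega

lemma stakeRank_lt {N : ℕ} (f : Fin N → ℕ) (i : Fin N) : stakeRank f i < N := by
  have h : stakeRank f i < (Finset.univ : Finset (Fin N)).card := by
    apply Finset.card_lt_card
    rw [Finset.ssubset_iff_of_subset (Finset.subset_univ _)]
    exact ⟨i, Finset.mem_univ _, by simp⟩
  simpa using h

lemma stakeRank_injective {N : ℕ} (f : Fin N → ℕ) : Function.Injective (stakeRank f) := by
  intro i j hij
  by_contra hne
  have hne' : i.val ≠ j.val := fun h => hne (Fin.ext h)
  rcases (by omega : (f i < f j ∨ (f i = f j ∧ i.val < j.val)) ∨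
      (f j < f i ∨ (f j = f i ∧ j.val < i.val))) with h | h
  · exact (stakeRank_lt_of_lex f h).ne hij
  · exact (stakeRank_lt_of_lex f h).ne' hij

lemma card_filter_stakeRank_lt {N n : ℕ} (hnN : n ≤ N) (f : Fin N → ℕ) :
    (Finset.univ.filter (fun i => stakeRank f i < n)).card = n := by
  have himage : Finset.univ.image (stakeRank f) = Finset.range N := by
    apply Finset.eq_of_subset_of_card_le
    · intro k hk
      obtain ⟨i, -, rfl⟩ := Finset.mem_image.1 hk
      exact Finset.mem_range.2 (stakeRank_lt f i)
    · simp [Finset.card_image_of_injective _ (stakeRank_injective f)]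
  rw [← Finset.card_image_of_injective _ (stakeRank_injective f),
    ← Finset.filter_image (p := fun k => k < n), himage]
  have : (Finset.range N).filter (fun k => k < n) = Finset.range n := by
    ext k
    simp only [Finset.mem_filter, Finset.mem_range]
    omega
  rw [this, Finset.card_range]


/-- **Lowest-stake selection: asymptotic selection frequency is `n/N`.**
Under the lowest-stake selection mechanism with unit rewards, every process is
selected with asymptotic frequency `n/N`: the sequence `l ↦ count i l / l` tends to
`(n : ℝ) / N` as `l → ∞`. In particular all processes have the same selection
frequency, so (processes having equal merit) the second fairness condition for
selection mechanisms is satisfied. -/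
theorem lowest_stake_selection_frequency
    (N n : ℕ) (hn : 0 < n) (hnN : n ≤ N)
    (s : ℕ → Fin N → ℕ) (C : ℕ → Finset (Fin N))
    (hs0 : ∀ i, s 0 i = 0)
    (hC : ∀ h (i : Fin N), i ∈ C h ↔
      (Finset.univ.filter (fun j : Fin N =>
        s h j < s h i ∨ (s h j = s h i ∧ j.val < i.val))).card < n)
    (hstep : ∀ h (i : Fin N), s (h+1) i = s h i + (if i ∈ C h then 1 else 0))
    (count : Fin N → ℕ → ℕ)
    (hcount : ∀ (i : Fin N) (l : ℕ),
      count i l = ((Finset.range l).filter (fun h => i ∈ C h)).card) :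
    ∀ i : Fin N,
      Filter.Tendsto (fun l : ℕ => (count i l : ℝ) / l) Filter.atTop
        (nhds ((n : ℝ) / N)) := by
  replace hC : ∀ h (i : Fin N), i ∈ C h ↔ stakeRank (s h) i < n := hC
  have hcard : ∀ h, (C h).card = n := fun h => by
    rw [← card_filter_stakeRank_lt hnN (s h)]
    congr 1
    ext i
    simp [hC]
  have hcount_eq : ∀ i l, count i l = s l i := fun i l => by
    rw [hcount]
    induction l with
    | zero => simp [hs0]
    | succ l ih =>
      rw [hstep, ← ih, Finset.card_filter, Finset.card_filter, Finset.sum_range_succ]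
  have hbalanced : ∀ h i j, s h i ≤ s h j + 1 := fun h => by
    induction h with
    | zero => simp [hs0]
    | succ h ih =>
      intro i j
      have hij := ih i j
      have hmem : s h j < s h i → i ∈ C h → j ∈ C h := fun hlt hi =>
        (hC h j).2 ((stakeRank_lt_of_lex (s h) (Or.inl hlt)).trans ((hC h i).1 hi))
      rw [hstep, hstep]
      split_ifs with hi hj hj
      · omega
      · have : ¬ s h j < s h i := fun hlt => hj (hmem hlt hi)
        omega
      · omega
      · omega
  have hsum : ∀ h, ∑ j, s h j = n * h := fun h => by
    induction h with
    | zero => simp [hs0]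
    | succ h ih =>
      simp only [hstep, Finset.sum_add_distrib, ih, Finset.sum_ite_mem, Finset.univ_inter,
        Finset.sum_const, hcard, smul_eq_mul]
      ring
  intro i
  have hN : (0 : ℝ) < N := by exact_mod_cast hn.trans_le hnN
  have hupper : ∀ l, N * s l i ≤ n * l + N := fun l => by
    have h := Finset.sum_le_sum fun j (_ : j ∈ Finset.univ) => hbalanced l i j
    simpa [Finset.sum_add_distrib, hsum] using h
  have hlower : ∀ l, n * l ≤ N * s l i + N := fun l => by
    have h := Finset.sum_le_sum fun j (_ : j ∈ Finset.univ) => hbalanced l j i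
    simpa [hsum, mul_add] using h
  rw [tendsto_iff_dist_tendsto_zero]
  refine squeeze_zero' (Filter.Eventually.of_forall fun _ => dist_nonneg) ?_
    tendsto_one_div_atTop_nhds_zero_nat
  filter_upwards [Filter.eventually_gt_atTop 0] with l hl
  have hl' : (0 : ℝ) < l := by exact_mod_cast hl
  have hu : (N : ℝ) * s l i ≤ n * l + N := by exact_mod_cast hupper l
  have hw : (n : ℝ) * l ≤ N * s l i + N := by exact_mod_cast hlower l
  rw [hcount_eq, Real.dist_eq, div_sub_div _ _ hl'.ne' hN.ne', abs_div,
    abs_of_pos (mul_pos hl' hN), div_le_div_iff₀ (mul_pos hl' hN) hl', one_mul, mul_comm]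
  refine mul_le_mul_of_nonneg_left ?_ hl'.le
  rw [abs_le]
  constructor <;> linarith
end

section
/- Under the lowest-stake selection mechanism with unit rewards, the stakes of any two processes differ by at most one at every height: for every height h and all processes i, j, s h i ≤ s h j + 1. -/
/-- **Lowest-stake selection: stakes differ by at most one.**
Under the lowest-stake selection mechanism with unit rewards, the stakes of any two
processes differ by at most one at every height. -/
theorem lowest_stake_stakes_balanced
    (N n : ℕ) (hn : 0 < n) (hnN : n ≤ N)
    (s : ℕ → Fin N → ℕ) (C : ℕ → Finset (Fin N))
    (hs0 : ∀ i, s 0 i = 0)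
    (hC : ∀ h (i : Fin N), i ∈ C h ↔
      (Finset.univ.filter (fun j : Fin N =>
        s h j < s h i ∨ (s h j = s h i ∧ j.val < i.val))).card < n)
    (hstep : ∀ h (i : Fin N), s (h+1) i = s h i + (if i ∈ C h then 1 else 0)) :
    ∀ (h : ℕ) (i j : Fin N), s h i ≤ s h j + 1 := by
  intro h
  induction h with
  | zero => simp [hs0]
  | succ h ih =>
    intro i j
    have mem_of_lt (hlt : s h j < s h i) (hi : i ∈ C h) : j ∈ C h := by
      rw [hC] at hi ⊢
      refine (Finset.card_le_card fun k hk => ?_).trans_lt hi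
      simp only [Finset.mem_filter, Finset.mem_univ, true_and] at hk ⊢
      omega
    have hij := ih i j
    rw [hstep, hstep]
    by_cases hlt : s h j < s h i
    · have := mem_of_lt hlt
      split_ifs <;> first | omega | tauto
    · split_ifs <;> omega
end

section
/- Under the highest-stake selection mechanism with unit rewards and equal initial stakes, the committee is the same at every height, namely the set of the n processes with smallest index: for every height h, C' h = {i : Fin N | i.val < n}. Consequently, if n < N, the process with index n is never selected although it has the same positive merit as the selected processes, so this selection mechanism violates the first fairness condition for selection mechanisms (a process with nonzero merit must be selected infinitely often). -/
/-- If stakes decrease weakly with the index, process `i` is outranked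
(larger stake, ties broken by smaller index) by exactly `i` processes. -/
theorem Antitone.card_filter_outranks {N : ℕ} {f : Fin N → ℕ} (hf : Antitone f) (i : Fin N) :
    (Finset.univ.filter (fun j : Fin N => f j > f i ∨ (f j = f i ∧ j.val < i.val))).card
      = i.val := by
  refine (congrArg Finset.card ?_).trans (Fin.card_Iio i)
  ext j
  simp only [Finset.mem_filter_univ, Finset.mem_Iio, Fin.val_fin_lt]
  constructor
  · rintro (h | h)
    · exact hf.reflect_lt h
    · exact h.2
  · intro h
    exact (hf h.le).lt_or_eq.imp id fun e => ⟨e.symm, h⟩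

/-- **Highest-stake selection is unfair.**
Under the highest-stake selection mechanism with unit rewards and equal (zero)
initial stakes, the committee is the same at every height, namely the `n` processes
of smallest index: `C' h = {i : Fin N | i.val < n}`. Consequently, if `n < N`, the
process with index `n` is never selected, although it has the same positive merit as
the selected processes; hence this selection mechanism violates the first fairness
condition (a process with nonzero merit must be selected infinitely often). -/
theorem highest_stake_unfair
    (N n : ℕ) (hn : 0 < n) (hnN : n ≤ N)
    (s : ℕ → Fin N → ℕ) (C' : ℕ → Finset (Fin N))
    (hs0 : ∀ i, s 0 i = 0)
    (hC' : ∀ h (i : Fin N), i ∈ C' h ↔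
      (Finset.univ.filter (fun j : Fin N =>
        s h j > s h i ∨ (s h j = s h i ∧ j.val < i.val))).card < n)
    (hstep : ∀ h (i : Fin N), s (h+1) i = s h i + (if i ∈ C' h then 1 else 0)) :
    (∀ h : ℕ, C' h = Finset.univ.filter (fun i : Fin N => i.val < n)) ∧
    (∀ hlt : n < N, ∀ h : ℕ, (⟨n, hlt⟩ : Fin N) ∉ C' h) := by
  have mem_of_antitone {h : ℕ} (hs : Antitone (s h)) (i : Fin N) : i ∈ C' h ↔ i.val < n := by
    rw [hC', hs.card_filter_outranks]
  have antitone_stake (h : ℕ) : Antitone (s h) := by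
    induction h with
    | zero => intro i j _; simp [hs0]
    | succ h ih =>
      intro i j hij
      have hle := ih hij
      have hval : i.val ≤ j.val := hij
      simp only [hstep, mem_of_antitone ih]
      split_ifs <;> omega
  have mem_iff (h : ℕ) (i : Fin N) : i ∈ C' h ↔ i.val < n := mem_of_antitone (antitone_stake h) i
  exact ⟨fun h => by ext i; simp [mem_iff], fun hlt h => by simp [mem_iff]⟩
end
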